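/- Let (J, ε, Δ) be a comonad on a category 𝒞 and let (ℰ, ρ) be any J-coalgebra. Then the commuting square with top ρ : ℰ → J ℰ, left ρ : ℰ → J ℰ, right Δ_ℰ : J ℰ → J (J ℰ), and bottom J(ρ) : J ℰ → J (J ℰ) is a pullback square. (In particular, every coalgebra, regarded as a generalized PDE via the monomorphism ρ : ℰ → J ℰ, is formally integrable: its prolongation, the pullback of Δ_ℰ along J(ρ), is canonically isomorphic to ℰ.) -/

import Mathlib

open CategoryTheory CategoryTheory.Limits

/-- For any coalgebra `(ℰ, ρ)` over a comonad `(J, ε, Δ)`, the square with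
top `ρ`, left `ρ`, right `Δ_ℰ` and bottom `J(ρ)` is a pullback square: every coalgebra,
regarded as a generalized PDE via `ρ : ℰ ⟶ J ℰ`, is formally integrable. -/
theorem statement11 {C : Type*} [Category C] (G : Comonad C)
    {ℰ : C} (ρ : ℰ ⟶ G.obj ℰ)
    (hcounit : ρ ≫ G.ε.app ℰ = 𝟙 ℰ)
    (hcoassoc : ρ ≫ G.map ρ = ρ ≫ G.δ.app ℰ) :
    IsPullback ρ ρ (G.δ.app ℰ) (G.map ρ) := by
  have key : ∀ {W : C} (a b : W ⟶ G.obj ℰ), a ≫ G.δ.app ℰ = b ≫ G.map ρ →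
      a = b ∧ (a ≫ G.ε.app ℰ) ≫ ρ = a := by
    intro W a b h
    have h1 : a = b := by
      have h2 := congrArg (fun t => t ≫ G.map (G.ε.app ℰ)) h
      simp only [Category.assoc] at h2
      rw [← G.map_comp, hcounit, G.map_id, Category.comp_id] at h2
      have h3 := G.right_counit ℰ
      rw [h3] at h2
      simpa using h2
    subst h1
    refine ⟨rfl, ?_⟩
    have h2 := congrArg (fun t => t ≫ G.ε.app (G.obj ℰ)) h
    simp only [Category.assoc] at h2
    have h3 := G.left_counit ℰ
    have h4 : G.map ρ ≫ G.ε.app (G.obj ℰ) = G.ε.app ℰ ≫ ρ := G.ε.naturality ρ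
    rw [h3, h4] at h2
    simpa using h2.symm
  refine ⟨⟨hcoassoc.symm⟩, ⟨PullbackCone.IsLimit.mk _ (fun s => s.fst ≫ G.ε.app ℰ) ?_ ?_ ?_⟩⟩
  · intro s
    exact (key s.fst s.snd s.condition).2
  · intro s
    exact (key s.fst s.snd s.condition).2.trans (key s.fst s.snd s.condition).1
  · intro s m h1 _
    rw [← h1, Category.assoc, hcounit, Category.comp_id]
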